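/- Let A be a commutative Noetherian local ring with depth A ≥ 2, let B be a finite flat A-algebra, and let N be a finite B-module. Then depth_A Hom_B(N,B) ≥ 2; more precisely, if a₁, a₂ is a regular sequence on A, then a₁ is a nonzerodivisor on Hom_B(N,B) and a₂ is a nonzerodivisor on the cokernel of multiplication by a₁ on Hom_B(N,B). -/

import Mathlib

open Pointwise

/-- The depth of a module `M` over a local ring `R`: the supremum of the lengths of
(weakly) regular `M`-sequences contained in the maximal ideal of `R`. -/
noncomputable def moduleDepth (R : Type*) [CommRing R] [IsLocalRing R]
    (M : Type*) [AddCommGroup M] [Module R M] : ℕ∞ :=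
  sSup {d : ℕ∞ | ∃ rs : List R, (rs.length : ℕ∞) = d ∧
    (∀ r ∈ rs, r ∈ IsLocalRing.maximalIdeal R) ∧ RingTheory.Sequence.IsWeaklyRegular M rs}

open RingTheory.Sequence in
/-- A pair `a, b` is weakly regular on `M` iff `a` is regular on `M` and `b • x ∈ a • M` implies
`x ∈ a • M`. -/
lemma isWeaklyRegular_pair_iff {R M : Type*} [CommRing R] [AddCommGroup M] [Module R M]
    {a b : R} :
    IsWeaklyRegular M [a, b] ↔
      IsSMulRegular M a ∧ ∀ x y : M, b • x = a • y → ∃ z, a • z = x := by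
  rw [isWeaklyRegular_cons_iff, isWeaklyRegular_singleton_iff,
    isSMulRegular_quotient_iff_mem_of_smul_mem]
  refine and_congr_right fun _ ↦ ?_
  simp only [Submodule.mem_smul_pointwise_iff_exists, Submodule.mem_top, true_and]
  exact ⟨fun h x y hxy ↦ h x ⟨y, hxy.symm⟩, fun h x ⟨y, hxy⟩ ↦ h x y hxy.symm⟩

open RingTheory.Sequence in
/-- A weakly regular pair on `M` is weakly regular on `Hom(N, M)`. -/
lemma RingTheory.Sequence.IsWeaklyRegular.linearMap_pair {A B N M : Type*} [CommRing A]
    [CommRing B] [Algebra A B] [AddCommGroup N] [Module B N] [AddCommGroup M] [Module A M]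
    [Module B M] [IsScalarTower A B M] {a b : A} (h : IsWeaklyRegular M [a, b]) :
    IsWeaklyRegular (N →ₗ[B] M) [a, b] := by
  obtain ⟨ha, hb⟩ := isWeaklyRegular_pair_iff.mp h
  refine isWeaklyRegular_pair_iff.mpr ⟨fun φ ψ hφψ ↦ ?_, fun φ χ hφχ ↦ ?_⟩
  · ext n
    exact ha (LinearMap.congr_fun hφψ n)
  · choose f hf using fun n ↦ hb (φ n) (χ n) (LinearMap.congr_fun hφχ n)
    refine ⟨{ toFun := f, map_add' := fun x y ↦ ha ?_, map_smul' := fun c x ↦ ha ?_ }, ?_⟩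
    · simp [smul_add, hf]
    · simp [smul_comm a c, hf]
    · ext n
      exact hf n

open RingTheory.Sequence in
/-- Depth at least two is witnessed by a weakly regular pair in the maximal ideal. -/
lemma two_le_moduleDepth_iff {R M : Type*} [CommRing R] [IsLocalRing R] [AddCommGroup M]
    [Module R M] :
    2 ≤ moduleDepth R M ↔ ∃ a ∈ IsLocalRing.maximalIdeal R, ∃ b ∈ IsLocalRing.maximalIdeal R,
      IsWeaklyRegular M [a, b] := by
  refine ⟨fun h ↦ ?_, fun ⟨a, ha, b, hb, hab⟩ ↦
    le_sSup ⟨[a, b], rfl, by simpa using And.intro ha hb, hab⟩⟩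
  obtain ⟨_, ⟨rs, rfl, hmem, hreg⟩, hlt⟩ :=
    lt_sSup_iff.mp ((show (1 : ℕ∞) < 2 by norm_num).trans_le h)
  match rs, hlt with
  | [], hlt => simp at hlt
  | [_], hlt => simp at hlt
  | a :: b :: l, _ =>
    exact ⟨a, hmem a (by simp), b, hmem b (by simp),
      ((isWeaklyRegular_append_iff M [a, b] l).mp hreg).1⟩

/-- If `A` is a Noetherian local ring with `depth A ≥ 2`, `B` a finite flat `A`-algebra and `N`
a finite `B`-module, then `depth_A Hom_B(N, B) ≥ 2`; more precisely, for any regular sequence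
`a₁, a₂` on `A`, `a₁` is a nonzerodivisor on `Hom_B(N, B)` and `a₂` is a nonzerodivisor on the
cokernel of multiplication by `a₁` on `Hom_B(N, B)`. -/
theorem depth_hom_ge_two {A B N : Type*} [CommRing A] [IsNoetherianRing A] [IsLocalRing A]
    [CommRing B] [Algebra A B] [Module.Finite A B] [Module.Flat A B]
    [AddCommGroup N] [Module B N] [Module.Finite B N]
    (hA : 2 ≤ moduleDepth A A) :
    2 ≤ moduleDepth A (N →ₗ[B] B) ∧
      ∀ a₁ a₂ : A, RingTheory.Sequence.IsRegular A [a₁, a₂] →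
        (∀ φ : N →ₗ[B] B, a₁ • φ = 0 → φ = 0) ∧
        (∀ ψ : (N →ₗ[B] B) ⧸ (a₁ • (⊤ : Submodule A (N →ₗ[B] B))),
          a₂ • ψ = 0 → ψ = 0) := by
  have key (a b : A) (h : RingTheory.Sequence.IsWeaklyRegular A [a, b]) :
      RingTheory.Sequence.IsWeaklyRegular (N →ₗ[B] B) [a, b] :=
    ((RingTheory.Sequence.isWeaklyRegular_map_algebraMap_iff B B _).mp
      (h.of_flat (S := B))).linearMap_pair
  refine ⟨?_, fun a₁ a₂ h ↦ ?_⟩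
  · obtain ⟨a, ha, b, hb, hab⟩ := two_le_moduleDepth_iff.mp hA
    exact two_le_moduleDepth_iff.mpr ⟨a, ha, b, hb, key a b hab⟩
  · have hreg := key a₁ a₂ h.toIsWeaklyRegular
    rw [RingTheory.Sequence.isWeaklyRegular_cons_iff,
      RingTheory.Sequence.isWeaklyRegular_singleton_iff] at hreg
    exact ⟨fun _ ↦ hreg.1.right_eq_zero_of_smul, fun _ ↦ hreg.2.right_eq_zero_of_smul⟩
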